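/- Assume [F_q : F_p] is even and F satisfies conditions (i)–(iv), and let n := [F_q:F_2] (an even number). Let t ∈ F_q satisfy Tr_{F_q/F_2}(t) = image of (n/2 + 1) in F_2. Then the curve y^p − y = x·R_{F,t}(x) is F_{q²}-maximal; that is, |{(x,y) ∈ F_{q²} × F_{q²} : y^p − y = x·R_{F,t}(x)}| = q² + (p−1)·p^e·q. -/

import Mathlib

open Finset

open scoped Classical

noncomputable section

/-- Length-two Witt vectors, with the operations specialised to characteristic two. -/
def W2 (R : Type*) := R × R

namespace W2

variable {R : Type*} [CommRing R]

instance : Zero (W2 R) := ⟨((0, 0) : R × R)⟩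

instance : Add (W2 R) := ⟨fun x y => ((x.1 + y.1, x.2 + y.2 + x.1 * y.1) : R × R)⟩

instance [CharP R 2] : Neg (W2 R) := ⟨fun x => ((x.1, x.2 + x.1 * x.1) : R × R)⟩

theorem fst_add (x y : W2 R) : (x + y).1 = x.1 + y.1 := rfl
theorem snd_add (x y : W2 R) : (x + y).2 = x.2 + y.2 + x.1 * y.1 := rfl
theorem fst_zero : (0 : W2 R).1 = 0 := rfl
theorem snd_zero : (0 : W2 R).2 = 0 := rfl
theorem fst_neg [CharP R 2] (x : W2 R) : (-x).1 = x.1 := rfl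
theorem snd_neg [CharP R 2] (x : W2 R) : (-x).2 = x.2 + x.1 * x.1 := rfl

instance [CharP R 2] : AddCommGroup (W2 R) where
  add := (· + ·)
  zero := 0
  neg := Neg.neg
  add_assoc a b c := Prod.ext_iff.mpr (by
    constructor <;> simp only [fst_add, snd_add] <;> ring)
  zero_add a := Prod.ext_iff.mpr (by
    constructor <;> simp [fst_add, snd_add, fst_zero, snd_zero])
  add_zero a := Prod.ext_iff.mpr (by
    constructor <;> simp [fst_add, snd_add, fst_zero, snd_zero])
  add_comm a b := Prod.ext_iff.mpr (by
    constructor <;> simp only [fst_add, snd_add] <;> ring)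
  neg_add_cancel a := Prod.ext_iff.mpr (by
    constructor
    · simp only [fst_add, fst_neg, fst_zero]
      exact CharTwo.add_self_eq_zero a.1
    · simp only [snd_add, snd_neg, snd_zero, fst_neg]
      rw [show a.2 + a.1 * a.1 + a.2 + a.1 * a.1
            = (a.2 + a.2) + (a.1 * a.1 + a.1 * a.1) by ring]
      rw [CharTwo.add_self_eq_zero, CharTwo.add_self_eq_zero, add_zero])
  nsmul := nsmulRec
  zsmul := zsmulRec

/-- Frobenius on length-two Witt vectors (characteristic two). -/
def frob (x : W2 R) : W2 R := ((x.1 ^ 2, x.2 ^ 2) : R × R)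

/-- The Witt-vector trace `Tr_{q/2} = ∑_{i=0}^{n-1} Frobⁱ`. -/
def tr [CharP R 2] (n : ℕ) (x : W2 R) : W2 R := ∑ i ∈ Finset.range n, frob^[i] x

/-- The additive character of `W₂(𝔽₂)` determined by `ξ₂(1,0) = I`
(for `I` a fixed primitive fourth root of unity), evaluated on Witt vectors
whose components lie in the prime field `𝔽₂ = {0,1}`. -/
def xi (I : ℂ) (x : W2 R) : ℂ := (if x.1 = 0 then 1 else I) * (if x.2 = 0 then 1 else -1)

end W2

variable {K : Type*}

/-- The absolute trace `Tr_{q/2} : 𝔽_q → 𝔽₂`, computed inside `K` (here `q = 2^n`). -/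
def tr2 [Field K] (n : ℕ) (x : K) : K := ∑ i ∈ Finset.range n, x ^ 2 ^ i

/-- The relative trace `Tr_{q/p} : 𝔽_q → 𝔽_p ⊆ 𝔽_q`, computed inside `K`
(here `q = p^m`). -/
def trp [Field K] (p m : ℕ) (x : K) : K := ∑ i ∈ Finset.range m, x ^ p ^ i

/-- The character `ψ_q(x) = (-1)^{Tr_{q/2}(x)}`. -/
def psiq [Field K] (n : ℕ) (x : K) : ℂ := if tr2 n x = 0 then 1 else -1

/-- The map `Q_q(x) = ξ₂(Tr_{q/2}(x,0))` on Witt vectors of length two. -/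
def Qq [Field K] [CharP K 2] (I : ℂ) (n : ℕ) (x : K) : ℂ :=
  W2.xi I (W2.tr n (((x, 0) : K × K) : W2 K))

/-- The unique `2^j`-th root in a perfect field of characteristic two. -/
def rt (L : Type*) [Field L] [ExpChar L 2] [PerfectRing L 2] (j : ℕ) (x : L) : L :=
  (fun y => (frobeniusEquiv L 2).symm y)^[j] x

/-- Evaluation of the `𝔽_p`-linearised polynomial `∑_{i=0}^{e} c_i x^{p^i}`. -/
def Lpoly [Field K] (p e : ℕ) (c : ℕ → K) (x : K) : K :=
  ∑ i ∈ Finset.range (e + 1), c i * x ^ p ^ i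

/-- The adjoint `f^*(x) = ∑_{i=0}^{e} (c_i x)^{p^{-i}}` (with `p = 2^k`). -/
def adj [Field K] [ExpChar K 2] [PerfectRing K 2] (k e : ℕ) (c : ℕ → K) (x : K) : K :=
  ∑ i ∈ Finset.range (e + 1), rt K (k * i) (c i * x)

/-- Evaluation of the `𝔽_p`-linearised polynomial `∑_{i=1}^{e} c_i x^{p^i}`
(no constant-in-`x` coefficient). -/
def LpolyIcc [Field K] (p e : ℕ) (c : ℕ → K) (x : K) : K :=
  ∑ i ∈ Finset.Icc 1 e, c i * x ^ p ^ i

/-- The adjoint `R^*(x) = ∑_{i=1}^{e} (c_i x)^{p^{-i}}` (with `p = 2^k`). -/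
def adjIcc [Field K] [ExpChar K 2] [PerfectRing K 2] (k e : ℕ) (c : ℕ → K) (x : K) : K :=
  ∑ i ∈ Finset.Icc 1 e, rt K (k * i) (c i * x)

/-- The coefficients `a_i = ∑_{j=0}^{e-i} (b_j b_{j+i})^{p^{-j}}` of `R_F` (with `p = 2^k`). -/
def aRF [Field K] [ExpChar K 2] [PerfectRing K 2] (k e : ℕ) (b : ℕ → K) (i : ℕ) : K :=
  ∑ j ∈ Finset.range (e - i + 1), rt K (k * j) (b j * b (j + i))

/-- The linearised polynomial `R_F(x) = ∑_{i=1}^{e} a_i x^{p^i}` (with `p = 2^k`). -/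
def RF [Field K] [ExpChar K 2] [PerfectRing K 2] (k e : ℕ) (b : ℕ → K) (x : K) : K :=
  ∑ i ∈ Finset.Icc 1 e, aRF k e b i * x ^ (2 ^ k) ^ i

/-- `γ_F = ∑_{0 ≤ i < j ≤ e} b_i^{p^{-i}} b_j^{p^{-j}}` (with `p = 2^k`). -/
def gammaF [Field K] [ExpChar K 2] [PerfectRing K 2] (k e : ℕ) (b : ℕ → K) : K :=
  ∑ i ∈ Finset.range (e + 1), ∑ j ∈ Finset.Ioo i (e + 1), rt K (k * i) (b i) * rt K (k * j) (b j)

/-- `α_F(t) = γ_F + F^*(t)²`. -/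
def alphaF [Field K] [ExpChar K 2] [PerfectRing K 2] (k e : ℕ) (b : ℕ → K) (t : K) : K :=
  gammaF k e b + adj k e b t ^ 2

/-- `R_{F,t}(x) = R_F(x) + α_F(t) x`. -/
def RFt [Field K] [ExpChar K 2] [PerfectRing K 2] (k e : ℕ) (b : ℕ → K) (t x : K) : K :=
  RF k e b x + alphaF k e b t * x

/-- The number of affine points of the van der Geer–van der Vlugt curve
`y^p - y = x R(x)` with coordinates in `K`. -/
def Ncount (K : Type*) [Field K] (p : ℕ) (R : K → K) : ℕ :=
  Nat.card {z : K × K // z.2 ^ p - z.2 = z.1 * R z.1}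

/-- The adjoint `F^*` of `F(x) = ∑_{i=0}^{e} b_i x^{p^i}`, with coefficients `b_i ∈ K`,
viewed as a function on the algebraic closure `𝔽` of `K`. -/
def adjBar [Field K] [CharP K 2] (k e : ℕ) (b : ℕ → K) (x : AlgebraicClosure K) : AlgebraicClosure K :=
  adj k e (fun i => algebraMap K (AlgebraicClosure K) (b i)) x

/-- `F(x) = ∑_{i=0}^{e} b_i x^{p^i}`, with coefficients `b_i ∈ K`, viewed as a function on
the algebraic closure `𝔽` of `K` (with `p = 2^k`). -/
def LpolyBar [Field K] [CharP K 2] (k e : ℕ) (b : ℕ → K) (x : AlgebraicClosure K) : AlgebraicClosure K :=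
  Lpoly (2 ^ k) e (fun i => algebraMap K (AlgebraicClosure K) (b i)) x


/-- `R_{F,t}`, viewed as a function on the algebraic closure of `K`. -/
def RFtBar {K : Type*} [Field K] [Fintype K] [CharP K 2] (k e : ℕ) (b : ℕ → K) (t : K)
    (x : AlgebraicClosure K) : AlgebraicClosure K :=
  (∑ i ∈ Finset.Icc 1 e, algebraMap K (AlgebraicClosure K) (aRF k e b i) * x ^ (2 ^ k) ^ i)
    + algebraMap K (AlgebraicClosure K) (alphaF k e b t) * x

section helpers

set_option linter.unusedSectionVars false

variable {Ω : Type*} [Field Ω] [CharP Ω 2]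

/-- Second elementary symmetric function of the conjugates. -/
def E2 (M : ℕ) (z : Ω) : Ω := ∑ j ∈ Finset.range M, tr2 j z * z ^ 2 ^ j

theorem two0 : (2 : Ω) = 0 := CharTwo.two_eq_zero

theorem tr2_zero' (z : Ω) : tr2 0 z = 0 := by simp [tr2]
theorem tr2_succ (M : ℕ) (z : Ω) : tr2 (M + 1) z = tr2 M z + z ^ 2 ^ M := by
  simp [tr2, Finset.sum_range_succ]
theorem E2_zero' (z : Ω) : E2 0 z = 0 := by simp [E2]
theorem E2_succ (M : ℕ) (z : Ω) : E2 (M + 1) z = E2 M z + tr2 M z * z ^ 2 ^ M := by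
  simp [E2, Finset.sum_range_succ]

theorem addpow (j : ℕ) (x y : Ω) : (x + y) ^ 2 ^ j = x ^ 2 ^ j + y ^ 2 ^ j :=
  add_pow_char_pow x y 2 j

theorem sumpow {ι : Type*} (j : ℕ) (s : Finset ι) (f : ι → Ω) :
    (∑ i ∈ s, f i) ^ 2 ^ j = ∑ i ∈ s, f i ^ 2 ^ j :=
  sum_pow_char_pow 2 j s f

theorem powinj (j : ℕ) {x y : Ω} (h : x ^ 2 ^ j = y ^ 2 ^ j) : x = y := by
  have : (x + y) ^ 2 ^ j = 0 := by
    rw [addpow, h]; exact CharTwo.add_self_eq_zero _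
  have := pow_eq_zero_iff (by positivity) |>.1 this
  exact CharTwo.add_eq_zero.1 this

theorem tr2_add (M : ℕ) (x y : Ω) : tr2 M (x + y) = tr2 M x + tr2 M y := by
  simp only [tr2, addpow, Finset.sum_add_distrib]

theorem tr2_0 (M : ℕ) : tr2 M (0 : Ω) = 0 := by
  simp [tr2]

theorem tr2_sum {ι : Type*} (M : ℕ) (s : Finset ι) (f : ι → Ω) :
    tr2 M (∑ i ∈ s, f i) = ∑ i ∈ s, tr2 M (f i) := by
  simp only [tr2, sumpow]
  rw [Finset.sum_comm]

theorem tr2_sq (M : ℕ) (z : Ω) : tr2 M z ^ 2 = tr2 M z + z ^ 2 ^ M + z := by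
  induction M with
  | zero => simp only [tr2_zero']; linear_combination (-z) * (two0 (Ω := Ω))
  | succ M ih =>
    rw [tr2_succ]
    have : z ^ 2 ^ (M + 1) = (z ^ 2 ^ M) ^ 2 := by rw [← pow_mul, pow_succ]
    rw [this]
    linear_combination ih + (tr2 M z * z ^ 2 ^ M) * (two0 (Ω := Ω))

theorem tr2_pow2 (M : ℕ) (z : Ω) : tr2 M (z ^ 2) = tr2 M z ^ 2 := by
  have := sumpow 1 (Finset.range M) (fun i => z ^ 2 ^ i)
  simp only [pow_one] at this
  rw [tr2, tr2, this]
  refine Finset.sum_congr rfl fun i _ => ?_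
  rw [← pow_mul, ← pow_mul, mul_comm]

theorem tr2_sq_fix {M : ℕ} {z : Ω} (hz : z ^ 2 ^ M = z) : tr2 M z ^ 2 = tr2 M z := by
  rw [tr2_sq, hz]; linear_combination z * (two0 (Ω := Ω))

theorem fixpow {M : ℕ} {z : Ω} (j : ℕ) (hz : z ^ 2 ^ M = z) : (z ^ j) ^ 2 ^ M = z ^ j := by
  rw [← pow_mul, mul_comm, pow_mul, hz]

theorem tr2_frob {M : ℕ} {z : Ω} (j : ℕ) (hz : z ^ 2 ^ M = z) : tr2 M (z ^ 2 ^ j) = tr2 M z := by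
  induction j with
  | zero => simp
  | succ j ih =>
    rw [pow_succ, pow_mul, tr2_pow2, tr2_sq_fix (fixpow _ hz), ih]

theorem E2_pol (M : ℕ) (x y : Ω) :
    E2 M (x + y) = E2 M x + E2 M y + tr2 M x * tr2 M y + tr2 M (x * y) := by
  induction M with
  | zero => simp [E2_zero', tr2_zero']
  | succ M ih =>
    simp only [E2_succ, tr2_succ, ih, tr2_add, addpow, mul_pow]
    linear_combination (-(x ^ 2 ^ M * y ^ 2 ^ M)) * (two0 (Ω := Ω))

theorem E2_pow2 (M : ℕ) (z : Ω) : E2 M (z ^ 2) = E2 M z ^ 2 := by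
  have := sumpow 1 (Finset.range M) (fun j => tr2 j z * z ^ 2 ^ j)
  simp only [pow_one] at this
  rw [E2, E2, this]
  refine Finset.sum_congr rfl fun i _ => ?_
  rw [mul_pow, tr2_pow2, ← pow_mul, ← pow_mul, mul_comm 2]

theorem E2_sq (M : ℕ) (z : Ω) :
    E2 M z ^ 2 = E2 M z + tr2 M z * z ^ 2 ^ M + z * tr2 M z + z * (z ^ 2 ^ M + z) := by
  induction M with
  | zero => simp only [E2_zero', tr2_zero']; linear_combination (-z^2) * (two0 (Ω := Ω))
  | succ M ih =>
    have h2 := tr2_sq M z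
    have : z ^ 2 ^ (M + 1) = (z ^ 2 ^ M) ^ 2 := by rw [← pow_mul, pow_succ]
    rw [E2_succ, tr2_succ, this]
    linear_combination ih + (z ^ 2 ^ M)^2 * h2 + (E2 M z * tr2 M z * z ^ 2 ^ M) * (two0 (Ω := Ω))

theorem E2_sq_fix {M : ℕ} {z : Ω} (hz : z ^ 2 ^ M = z) : E2 M z ^ 2 = E2 M z := by
  rw [E2_sq, hz]; linear_combination (tr2 M z * z + z^2) * (two0 (Ω := Ω))

theorem E2_frob {M : ℕ} {z : Ω} (j : ℕ) (hz : z ^ 2 ^ M = z) : E2 M (z ^ 2 ^ j) = E2 M z := by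
  induction j with
  | zero => simp
  | succ j ih =>
    rw [pow_succ, pow_mul, E2_pow2, E2_sq_fix (fixpow _ hz), ih]

theorem tr2_split (n r : ℕ) (z : Ω) : tr2 (n + r) z = tr2 n z + tr2 r (z ^ 2 ^ n) := by
  induction r with
  | zero => simp [tr2_zero']
  | succ r ih =>
    rw [← add_assoc, tr2_succ, tr2_succ, ih, ← pow_mul, ← pow_add]; ring

theorem E2_split (n r : ℕ) (z : Ω) :
    E2 (n + r) z = E2 n z + tr2 n z * tr2 r (z ^ 2 ^ n) + E2 r (z ^ 2 ^ n) := by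
  induction r with
  | zero => simp [tr2_zero', E2_zero']
  | succ r ih =>
    rw [← add_assoc, E2_succ, tr2_succ, E2_succ, ih, tr2_split, ← pow_mul, ← pow_add]; ring

theorem E2_base {n : ℕ} {z : Ω} (hz : z ^ 2 ^ n = z) : E2 (n + n) z = tr2 n z := by
  rw [E2_split, hz]
  linear_combination tr2_sq_fix hz + (E2 n z) * (two0 (Ω := Ω))

theorem tr2_one (n : ℕ) : tr2 n (1 : Ω) = n := by simp [tr2]

theorem even_cast {n : ℕ} (h : Even n) : (n : Ω) = 0 := by
  obtain ⟨r, rfl⟩ := h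
  push_cast; exact CharTwo.add_self_eq_zero _

theorem E2_one {n : ℕ} (h : Even n) : E2 n (1 : Ω) = ((n / 2 : ℕ) : Ω) := by
  obtain ⟨r, rfl⟩ := h
  induction r with
  | zero => simp [E2_zero']
  | succ r ih =>
    have e1 : r + 1 + (r + 1) = r + r + 1 + 1 := by ring
    have e2 : (r + 1 + (r + 1)) / 2 = r + 1 := by omega
    have e3 : (r + r) / 2 = r := by omega
    rw [e3] at ih
    rw [e2, e1, E2_succ, E2_succ, ih, tr2_one, tr2_one]
    push_cast
    simp only [one_pow]
    linear_combination (2 * (r : Ω)) * (two0 (Ω := Ω))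

theorem E2_artin {n : ℕ} (hn : Even n) {z : Ω} (hz : z ^ 2 ^ n = z + 1) :
    E2 (n + n) z = ((n / 2 : ℕ) : Ω) + 1 := by
  have h := tr2_sq n z
  rw [hz] at h
  rw [E2_split, hz, E2_pol, tr2_add, tr2_one, even_cast hn, E2_one hn, mul_one]
  linear_combination h + (E2 n z + tr2 n z + z) * (two0 (Ω := Ω))

theorem E2_0 (M : ℕ) : E2 M (0 : Ω) = 0 := by simp [E2]

theorem E2_sum (M s : ℕ) (z : ℕ → Ω) :
    E2 M (∑ i ∈ Finset.range s, z i) = ∑ i ∈ Finset.range s, E2 M (z i)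
      + ∑ j ∈ Finset.range s, ∑ i ∈ Finset.range j, (tr2 M (z i) * tr2 M (z j) + tr2 M (z i * z j)) := by
  induction s with
  | zero => simp [E2_0]
  | succ s ih =>
    rw [Finset.sum_range_succ, E2_pol, ih, Finset.sum_range_succ, Finset.sum_range_succ,
      tr2_sum, Finset.sum_mul, Finset.sum_mul, tr2_sum, Finset.sum_add_distrib]
    ring

/-- sign -/
def sg (a : Ω) : ℤ := if a = 0 then 1 else -1

theorem idem {a : Ω} (h : a ^ 2 = a) : a = 0 ∨ a = 1 := by
  have : a * (a - 1) = 0 := by linear_combination h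
  rcases mul_eq_zero.1 this with h | h
  · exact Or.inl h
  · exact Or.inr (sub_eq_zero.1 h)

theorem sg_add {a b : Ω} (ha : a ^ 2 = a) (hb : b ^ 2 = b) : sg (a + b) = sg a * sg b := by
  have h11 : (1 : Ω) + 1 = 0 := CharTwo.add_self_eq_zero _
  rcases idem ha with rfl | rfl <;> rcases idem hb with rfl | rfl <;> simp [sg, h11]

/-- rt facts -/
theorem rt_pow [PerfectRing Ω 2] (j : ℕ) (x : Ω) : rt Ω j x ^ 2 ^ j = x := by
  induction j generalizing x with
  | zero => simp [rt]
  | succ j ih =>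
    have : rt Ω (j + 1) x = rt Ω j ((frobeniusEquiv Ω 2).symm x) := by
      simp [rt, Function.iterate_succ]
    rw [this, pow_succ, pow_mul, ih]
    exact frobeniusEquiv_symm_pow_p Ω 2 x

theorem rt_mul [PerfectRing Ω 2] (j : ℕ) (x y : Ω) : rt Ω j (x * y) = rt Ω j x * rt Ω j y := by
  apply powinj j
  rw [mul_pow, rt_pow, rt_pow, rt_pow]

theorem rt_fix [PerfectRing Ω 2] (j : ℕ) {n : ℕ} {x : Ω} (hx : x ^ 2 ^ n = x) :
    rt Ω j x ^ 2 ^ n = rt Ω j x := by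
  apply powinj j
  rw [← pow_mul, mul_comm, pow_mul, rt_pow, hx]

theorem rt_map {K : Type*} [Field K] [CharP K 2] [PerfectRing K 2] [PerfectRing Ω 2] (f : K →+* Ω)
    (j : ℕ) (x : K) : f (rt K j x) = rt Ω j (f x) := by
  apply powinj j
  rw [rt_pow, ← map_pow, rt_pow]

/-- fixed set of Frobenius^n -/
def Fx (Ω : Type*) [Field Ω] (n : ℕ) : Finset Ω :=
  (Polynomial.X ^ 2 ^ n - Polynomial.X : Polynomial Ω).roots.toFinset

theorem mem_Fx {n : ℕ} (hn : 1 ≤ n) {x : Ω} : x ∈ Fx Ω n ↔ x ^ 2 ^ n = x := by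
  have h1 : 1 < 2 ^ n := Nat.one_lt_two_pow (by omega)
  rw [Fx, Multiset.mem_toFinset, Polynomial.mem_roots
    (FiniteField.X_pow_card_sub_X_ne_zero Ω h1)]
  simp [sub_eq_zero]

theorem card_Fx [IsAlgClosed Ω] {n : ℕ} (hn : 1 ≤ n) : (Fx Ω n).card = 2 ^ n := by
  have h1 : 1 < 2 ^ n := Nat.one_lt_two_pow (by omega)
  have hs : (Polynomial.X ^ 2 ^ n - Polynomial.X : Polynomial Ω).Separable :=
    galois_poly_separable 2 _ (dvd_pow_self 2 (by omega))
  rw [Fx, Multiset.toFinset_card_of_nodup (Polynomial.nodup_roots hs),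
    IsAlgClosed.card_roots_eq_natDegree, FiniteField.X_pow_card_sub_X_natDegree_eq Ω h1]

theorem exists_tr [IsAlgClosed Ω] {n : ℕ} (hn : 1 ≤ n) : ∃ x ∈ Fx Ω n, tr2 n x ≠ 0 := by
  by_contra hcon
  push Not at hcon
  let P : Polynomial Ω := ∑ i ∈ Finset.range n, Polynomial.X ^ 2 ^ i
  have hdeg : P.natDegree ≤ 2 ^ (n - 1) := by
    apply Polynomial.natDegree_sum_le_of_forall_le
    intro i hi
    rw [Polynomial.natDegree_X_pow]
    exact Nat.pow_le_pow_right (by norm_num) (by have := Finset.mem_range.1 hi; omega)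
  have hP : P ≠ 0 := by
    intro h
    have := congrArg (fun Q => Polynomial.coeff Q 1) h
    simp only [P, Polynomial.finsetSum_coeff, Polynomial.coeff_X_pow, Polynomial.coeff_zero] at this
    rw [Finset.sum_eq_single 0] at this
    · simp at this
    · intro i _ hi
      have : 1 < 2 ^ i := Nat.one_lt_two_pow hi
      rw [if_neg (by omega)]
    · intro h; simp at h; omega
  have hsub : Fx Ω n ⊆ P.roots.toFinset := by
    intro x hx
    rw [Multiset.mem_toFinset, Polynomial.mem_roots hP]
    have := hcon x hx
    simpa [P, Polynomial.IsRoot, Polynomial.eval_finsetSum, tr2] using this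
  have h1 := Finset.card_le_card hsub
  have h2 := Multiset.toFinset_card_le P.roots
  have h3 := Polynomial.card_roots' P
  rw [card_Fx hn] at h1
  have : 2 ^ (n - 1) < 2 ^ n := Nat.pow_lt_pow_right (by norm_num) (by omega)
  omega

theorem fx_add {n : ℕ} {x y : Ω} (hx : x ^ 2 ^ n = x) (hy : y ^ 2 ^ n = y) :
    (x + y) ^ 2 ^ n = x + y := by rw [addpow, hx, hy]
theorem fx_mul {n : ℕ} {x y : Ω} (hx : x ^ 2 ^ n = x) (hy : y ^ 2 ^ n = y) :
    (x * y) ^ 2 ^ n = x * y := by rw [mul_pow, hx, hy]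
theorem fx_sum {ι : Type*} {n : ℕ} (s : Finset ι) (f : ι → Ω) (h : ∀ i ∈ s, f i ^ 2 ^ n = f i) :
    (∑ i ∈ s, f i) ^ 2 ^ n = ∑ i ∈ s, f i := by
  rw [sumpow]; exact Finset.sum_congr rfl h
theorem fx_dbl {n : ℕ} {x : Ω} (hx : x ^ 2 ^ n = x) : x ^ 2 ^ (n + n) = x := by
  rw [pow_add, pow_mul, hx, hx]

theorem orth [IsAlgClosed Ω] {n : ℕ} (hn : 1 ≤ n) {a : Ω} (ha : a ^ 2 ^ n = a) :
    ∑ u ∈ Fx Ω n, sg (tr2 n (a * u)) = if a = 0 then 2 ^ n else 0 := by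
  split_ifs with h
  · subst h
    simp [tr2_0, sg, card_Fx hn]
  · obtain ⟨w, hw, hw1⟩ := exists_tr (Ω := Ω) hn
    have hw' := (mem_Fx hn).1 hw
    set v := a⁻¹ * w with hv
    have hvf : v ^ 2 ^ n = v := by rw [hv, mul_pow, inv_pow, ha, hw']
    have hav : a * v = w := by rw [hv, ← mul_assoc, mul_inv_cancel₀ h, one_mul]
    have key : ∑ u ∈ Fx Ω n, sg (tr2 n (a * u)) = ∑ u ∈ Fx Ω n, - sg (tr2 n (a * u)) := by
      refine Finset.sum_bij' (fun u _ => u + v) (fun u _ => u + v) ?_ ?_ ?_ ?_ ?_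
      · intro u hu; exact (mem_Fx hn).2 (fx_add ((mem_Fx hn).1 hu) hvf)
      · intro u hu; exact (mem_Fx hn).2 (fx_add ((mem_Fx hn).1 hu) hvf)
      · intro u _; rw [add_assoc, CharTwo.add_self_eq_zero, add_zero]
      · intro u _; rw [add_assoc, CharTwo.add_self_eq_zero, add_zero]
      · intro u hu
        have hu' := (mem_Fx hn).1 hu
        rw [mul_add, tr2_add, hav, sg_add (tr2_sq_fix (fx_mul ha hu')) (tr2_sq_fix hw')]
        have : sg (tr2 n w) = -1 := by simp [sg, hw1]
        rw [this]; ring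
    rw [Finset.sum_neg_distrib] at key
    linarith

theorem powpow (k i : ℕ) (x : Ω) : x ^ (2 ^ k) ^ i = x ^ 2 ^ (k * i) := by rw [← pow_mul]

theorem Lpoly_eq (k e : ℕ) (β : ℕ → Ω) (x : Ω) :
    Lpoly (2 ^ k) e β x = ∑ i ∈ Finset.range (e + 1), β i * x ^ 2 ^ (k * i) := by
  simp only [Lpoly, powpow]

theorem Lpoly_add (k e : ℕ) (β : ℕ → Ω) (x y : Ω) :
    Lpoly (2 ^ k) e β (x + y) = Lpoly (2 ^ k) e β x + Lpoly (2 ^ k) e β y := by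
  simp only [Lpoly_eq, addpow, mul_add, Finset.sum_add_distrib]

theorem Lpoly_frob {n : ℕ} (k e : ℕ) (β : ℕ → Ω) (hβ : ∀ i, β i ^ 2 ^ n = β i) (x : Ω) :
    Lpoly (2 ^ k) e β x ^ 2 ^ n = Lpoly (2 ^ k) e β (x ^ 2 ^ n) := by
  simp only [Lpoly_eq, sumpow, mul_pow, hβ]
  refine Finset.sum_congr rfl fun i _ => ?_
  rw [← pow_mul, ← pow_mul, mul_comm (2 ^ n)]

theorem lin_roots [IsAlgClosed Ω] (k e : ℕ) (hk : 1 ≤ k) (he : 1 ≤ e) (β : ℕ → Ω) (h0 : β 0 ≠ 0)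
    (h1 : β e ≠ 0) (y : Ω) :
    ∃ S : Finset Ω, S.card = 2 ^ (k * e) ∧ ∀ x, x ∈ S ↔ Lpoly (2 ^ k) e β x = y := by
  let P : Polynomial Ω := ∑ i ∈ Finset.range (e + 1), Polynomial.C (β i) * Polynomial.X ^ 2 ^ (k * i)
    - Polynomial.C y
  have hder : Polynomial.derivative P = Polynomial.C (β 0) := by
    simp only [P, Polynomial.derivative_sub, Polynomial.derivative_sum, Polynomial.derivative_C,
      sub_zero, Polynomial.derivative_C_mul_X_pow]
    rw [Finset.sum_eq_single 0]
    · simp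
    · intro i _ hi
      have : ((2 ^ (k * i) : ℕ) : Ω) = 0 := by
        push_cast; rw [two0]; exact zero_pow (by positivity)
      rw [this]; simp
    · intro h; simp at h
  have hsep : P.Separable := by
    rw [Polynomial.separable_def, hder]
    exact (isCoprime_one_right).of_isCoprime_of_dvd_right
      (Polynomial.isUnit_C.2 (isUnit_iff_ne_zero.2 h0)).dvd
  have hdeg : P.natDegree = 2 ^ (k * e) := by
    have hpos : 0 < 2 ^ (k * e) := by positivity
    simp only [P]
    rw [Polynomial.natDegree_sub_C, Finset.sum_range_succ]
    rw [Polynomial.natDegree_add_eq_right_of_natDegree_lt, Polynomial.natDegree_C_mul_X_pow _ _ h1]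
    rw [Polynomial.natDegree_C_mul_X_pow _ _ h1]
    obtain ⟨e', rfl⟩ : ∃ e', e = e' + 1 := ⟨e - 1, by omega⟩
    have : (∑ i ∈ Finset.range (e' + 1),
        Polynomial.C (β i) * Polynomial.X ^ 2 ^ (k * i)).natDegree ≤ 2 ^ (k * e') := by
      apply Polynomial.natDegree_sum_le_of_forall_le
      intro i hi
      refine (Polynomial.natDegree_C_mul_X_pow_le _ _).trans ?_
      exact Nat.pow_le_pow_right (by norm_num)
        (Nat.mul_le_mul_left _ (by have := Finset.mem_range.1 hi; omega))
    refine this.trans_lt (Nat.pow_lt_pow_right (by norm_num) ?_)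
    rw [mul_add]; omega
  have hP : P ≠ 0 := hsep.ne_zero
  refine ⟨P.roots.toFinset, ?_, ?_⟩
  · rw [Multiset.toFinset_card_of_nodup (Polynomial.nodup_roots hsep),
      IsAlgClosed.card_roots_eq_natDegree, hdeg]
  · intro x
    rw [Multiset.mem_toFinset, Polynomial.mem_roots hP, Lpoly_eq]
    simp [P, Polynomial.IsRoot, Polynomial.eval_finsetSum, sub_eq_zero]

theorem tr_adj [PerfectRing Ω 2] {M : ℕ} (k e : ℕ) (β : ℕ → Ω) (hβ : ∀ i, β i ^ 2 ^ M = β i)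
    {t x : Ω} (ht : t ^ 2 ^ M = t) (hx : x ^ 2 ^ M = x) :
    tr2 M (adj k e β t * x) = tr2 M (t * Lpoly (2 ^ k) e β x) := by
  rw [adj, Lpoly_eq, Finset.sum_mul, Finset.mul_sum, tr2_sum, tr2_sum]
  refine Finset.sum_congr rfl fun i _ => ?_
  rw [← tr2_frob (k * i) (fx_mul (rt_fix _ (fx_mul (hβ i) ht)) hx), mul_pow, rt_pow]
  congr 1; ring

theorem E2_F [PerfectRing Ω 2] {M : ℕ} (k e : ℕ) (β : ℕ → Ω) (hβ : ∀ i, β i ^ 2 ^ M = β i)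
    (h1 : adj k e β 1 = 0) {x : Ω} (hx : x ^ 2 ^ M = x) :
    E2 M (Lpoly (2 ^ k) e β x) = tr2 M (x * RF k e β x) + tr2 M (gammaF k e β * x ^ 2) := by
  set z : ℕ → Ω := fun i => β i * x ^ 2 ^ (k * i) with hz
  set w : ℕ → Ω := fun i => rt Ω (k * i) (β i) * x with hw
  have hwz : ∀ i, w i ^ 2 ^ (k * i) = z i := by
    intro i; simp only [hz, hw]; rw [mul_pow, rt_pow]
  have hwf : ∀ i, w i ^ 2 ^ M = w i := fun i => fx_mul (rt_fix _ (hβ i)) hx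
  have hE : ∀ i, E2 M (z i) = E2 M (w i) := by
    intro i; rw [← hwz, E2_frob _ (hwf i)]
  have hT : ∀ i, tr2 M (z i) = tr2 M (w i) := by
    intro i; rw [← hwz, tr2_frob _ (hwf i)]
  have hw0 : ∑ i ∈ Finset.range (e + 1), w i = 0 := by
    simp only [hw]; rw [← Finset.sum_mul]
    simp only [adj, mul_one] at h1
    rw [h1, zero_mul]
  have e1 := E2_sum M (e + 1) z
  have e2 := E2_sum M (e + 1) w
  rw [hw0, E2_0] at e2
  simp only [Finset.sum_add_distrib, hE, hT] at e1 e2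
  have hG : tr2 M (gammaF k e β * x ^ 2)
      = ∑ j ∈ Finset.range (e + 1), ∑ i ∈ Finset.range j, tr2 M (w i * w j) := by
    rw [gammaF, Finset.sum_mul, tr2_sum]
    rw [Finset.sum_comm' (t' := Finset.range (e + 1)) (s' := fun i => Finset.Ioo i (e + 1))]
    · refine Finset.sum_congr rfl fun i _ => ?_
      rw [Finset.sum_mul, tr2_sum]
      refine Finset.sum_congr rfl fun j _ => ?_
      congr 1; simp only [hw]; ring
    · intro i j
      simp only [Finset.mem_range, Finset.mem_Ioo]; omega
  have hR : tr2 M (x * RF k e β x)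
      = ∑ j ∈ Finset.range (e + 1), ∑ i ∈ Finset.range j, tr2 M (z i * z j) := by
    rw [RF, Finset.mul_sum, tr2_sum]
    have : ∀ d ∈ Finset.Icc 1 e, tr2 M (x * (aRF k e β d * x ^ (2 ^ k) ^ d))
        = ∑ i ∈ Finset.range (e - d + 1), tr2 M (z i * z (i + d)) := by
      intro d _
      rw [aRF, Finset.sum_mul, Finset.mul_sum, tr2_sum]
      refine Finset.sum_congr rfl fun i _ => ?_
      rw [powpow, ← tr2_frob (k * i)
        (fx_mul hx (fx_mul (rt_fix _ (fx_mul (hβ i) (hβ (i + d)))) (fixpow _ hx)))]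
      congr 1
      rw [mul_pow, mul_pow, rt_pow, ← pow_mul, ← pow_add]
      simp only [hz]
      rw [show k * d + k * i = k * (i + d) by ring]
      ring
    rw [Finset.sum_congr rfl this, Finset.sum_sigma', Finset.sum_sigma']
    refine Finset.sum_bij' (fun a _ => ⟨a.2 + a.1, a.2⟩) (fun a _ => ⟨a.1 - a.2, a.2⟩) ?_ ?_ ?_ ?_ ?_
    · rintro ⟨d, i⟩ h
      simp only [Finset.mem_sigma, Finset.mem_Icc, Finset.mem_range] at h ⊢; omega
    · rintro ⟨j, i⟩ h
      simp only [Finset.mem_sigma, Finset.mem_Icc, Finset.mem_range] at h ⊢; omega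
    · rintro ⟨d, i⟩ h
      simp
    · rintro ⟨j, i⟩ h
      simp only [Finset.mem_sigma, Finset.mem_Icc, Finset.mem_range] at h
      have : i + (j - i) = j := by omega
      simp [this]
    · rintro ⟨d, i⟩ h
      rfl
  rw [Lpoly_eq, e1, hR, hG]
  linear_combination (-1 : Ω) * e2 -
    (∑ j ∈ Finset.range (e + 1), ∑ i ∈ Finset.range j, tr2 M (w i * w j)) * (two0 (Ω := Ω))

theorem tr_RFt [PerfectRing Ω 2] {M : ℕ} (k e : ℕ) (β : ℕ → Ω) (hβ : ∀ i, β i ^ 2 ^ M = β i)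
    (h1 : adj k e β 1 = 0) {t x : Ω} (ht : t ^ 2 ^ M = t) (hx : x ^ 2 ^ M = x) :
    tr2 M (x * RFt k e β t x)
      = E2 M (Lpoly (2 ^ k) e β x) + tr2 M (t * Lpoly (2 ^ k) e β x) := by
  have hadj : adj k e β t ^ 2 ^ M = adj k e β t := by
    apply fx_sum; intro i _; exact rt_fix _ (fx_mul (hβ i) ht)
  rw [E2_F k e β hβ h1 hx, ← tr_adj k e β hβ ht hx, ← tr2_frob 1 (fx_mul hadj hx), pow_one,
    ← tr2_add, ← tr2_add]
  congr 1
  rw [RFt, alphaF]; ring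

theorem tr_F [PerfectRing Ω 2] {M : ℕ} (k e : ℕ) (β : ℕ → Ω) (hβ : ∀ i, β i ^ 2 ^ M = β i)
    (h1 : adj k e β 1 = 0) {x : Ω} (hx : x ^ 2 ^ M = x) :
    tr2 M (Lpoly (2 ^ k) e β x) = 0 := by
  have := tr_adj k e β hβ (one_pow _) hx
  rw [h1, zero_mul, tr2_0, one_mul] at this
  exact this.symm

theorem S1 [PerfectRing Ω 2] [IsAlgClosed Ω] {n : ℕ} (hn : 1 ≤ n) (hne : Even n) (k e : ℕ)
    (hk : 1 ≤ k) (he : 1 ≤ e)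
    (β : ℕ → Ω) (hβ : ∀ i, β i ^ 2 ^ n = β i) (hb0 : β 0 ≠ 0) (hbe : β e ≠ 0)
    (h1 : adj k e β 1 = 0)
    (h4 : ∀ x, adj k e β (Lpoly (2 ^ k) e β x) = 0 → x ^ 2 ^ n = x)
    {t : Ω} (ht : t ^ 2 ^ n = t) (htr : tr2 n t = ((n / 2 + 1 : ℕ) : Ω)) :
    ∑ x ∈ Fx Ω (n + n), sg (tr2 (n + n) (x * RFt k e β t x)) = 2 ^ (k * e) * 2 ^ n := by
  set F := Lpoly (2 ^ k) e β with hF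
  have hβM : ∀ i, β i ^ 2 ^ (n + n) = β i := fun i => fx_dbl (hβ i)
  have htM := fx_dbl ht
  have hM : 1 ≤ n + n := by omega
  have hFadd : ∀ x y, F (x + y) = F x + F y := fun x y => Lpoly_add k e β x y
  have hFfr : ∀ x, F x ^ 2 ^ n = F (x ^ 2 ^ n) := fun x => Lpoly_frob k e β hβ x
  have hFM : ∀ x, x ^ 2 ^ (n + n) = x → F x ^ 2 ^ (n + n) = F x := fun x hx => by
    rw [hF, Lpoly_frob k e β hβM, hx]
  have adj0 : adj k e β 0 = 0 := by
    rw [adj]; apply Finset.sum_eq_zero; intro i _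
    apply powinj (k * i); rw [rt_pow]; simp
  have hker : ∀ x, F x = 0 → x ^ 2 ^ n = x := fun x hx => h4 x (by rw [hx, adj0])
  have hU : ∀ x, F x ^ 2 ^ n = F x → x ^ 2 ^ (n + n) = x := by
    intro x hx
    have h2 : F (x ^ 2 ^ n + x) = 0 := by
      rw [hFadd, ← hFfr, hx]; exact CharTwo.add_self_eq_zero _
    have h3 := hker _ h2
    rw [addpow, ← pow_mul, ← pow_add] at h3
    linear_combination h3
  set U := (Fx Ω (n + n)).filter (fun x => F x ^ 2 ^ n = F x) with hUdef
  have memU : ∀ x, x ∈ U ↔ F x ^ 2 ^ n = F x := by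
    intro x
    rw [hUdef, Finset.mem_filter, mem_Fx hM]
    exact ⟨fun h => h.2, fun h => ⟨hU x h, h⟩⟩
  -- fibres
  have fib : ∀ g : Ω → ℤ, ∑ u ∈ U, g (F u) = 2 ^ (k * e) * ∑ y ∈ Fx Ω n, g y := by
    intro g
    have hmaps : ∀ u ∈ U, F u ∈ Fx Ω n := fun u hu => (mem_Fx hn).2 ((memU u).1 hu)
    rw [← Finset.sum_fiberwise_of_maps_to hmaps, Finset.mul_sum]
    refine Finset.sum_congr rfl fun y hy => ?_
    obtain ⟨S, hS1, hS2⟩ := lin_roots k e hk he β hb0 hbe y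
    have : U.filter (fun u => F u = y) = S := by
      ext u
      rw [Finset.mem_filter, hS2, memU]
      refine ⟨fun h => h.2, fun h => ⟨?_, h⟩⟩
      rw [hF, h]; exact (mem_Fx hn).1 hy
    rw [Finset.sum_congr rfl (g := fun _ => g y)
      (fun u hu => by rw [(Finset.mem_filter.1 hu).2]), this]
    simp [hS1]
  have cardU : (U.card : ℤ) = 2 ^ (k * e) * 2 ^ n := by
    have := fib (fun _ => 1)
    simpa [card_Fx hn] using this
  set f : Ω → Ω := fun x => tr2 (n + n) (x * RFt k e β t x) with hf
  have hfE : ∀ x, x ^ 2 ^ (n + n) = x → f x = E2 (n + n) (F x) + tr2 (n + n) (t * F x) :=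
    fun x hx => tr_RFt k e β hβM h1 htM hx
  have hfid : ∀ x, x ^ 2 ^ (n + n) = x → f x ^ 2 = f x := by
    intro x hx
    have e1 := E2_sq_fix (hFM x hx)
    have e2 := tr2_sq_fix (fx_mul htM (hFM x hx))
    rw [hfE x hx]
    linear_combination e1 + e2 + (E2 (n + n) (F x) * tr2 (n + n) (t * F x)) * (two0 (Ω := Ω))
  have trK : ∀ z y : Ω, z ^ 2 ^ (n + n) = z → y ^ 2 ^ n = y →
      tr2 (n + n) (z * y) = tr2 n ((z + z ^ 2 ^ n) * y) := by
    intro z y hz hy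
    rw [tr2_split, mul_pow, hy, add_mul, tr2_add]
  have cfix : ∀ x, x ^ 2 ^ (n + n) = x →
      (1 + F x + F x ^ 2 ^ n) ^ 2 ^ n = 1 + F x + F x ^ 2 ^ n := by
    intro x hx
    rw [addpow, addpow, one_pow, ← pow_mul, ← pow_add, hFM x hx]; ring
  have shift : ∀ x, x ^ 2 ^ (n + n) = x → ∀ u ∈ U,
      sg (f (x + u)) = sg (f x) * sg (tr2 n ((1 + F x + F x ^ 2 ^ n) * F u)) := by
    intro x hx u hu
    have hy := (memU u).1 hu
    have hu' := hU u hy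
    rw [← sg_add (hfid x hx) (tr2_sq_fix (fx_mul (cfix x hx) hy))]
    congr 1
    rw [hfE _ (fx_add hx hu'), hfE x hx, hFadd, E2_pol, tr_F k e β hβM h1 hx, E2_base hy,
      trK _ _ (hFM x hx) hy, mul_add, tr2_add, trK t _ htM hy, ht, CharTwo.add_self_eq_zero t,
      zero_mul, zero_mul, tr2_0, add_assoc 1, add_mul 1, one_mul, tr2_add]
    ring
  have main : (U.card : ℤ) * ∑ x ∈ Fx Ω (n + n), sg (f x)
      = ∑ x ∈ Fx Ω (n + n), sg (f x) *
        (if 1 + F x + F x ^ 2 ^ n = 0 then (U.card : ℤ) else 0) := by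
    have step1 : ∀ u ∈ U, ∑ x ∈ Fx Ω (n + n), sg (f (x + u)) = ∑ x ∈ Fx Ω (n + n), sg (f x) := by
      intro u hu
      have hu' := hU u ((memU u).1 hu)
      refine Finset.sum_bij' (fun x _ => x + u) (fun x _ => x + u) ?_ ?_ ?_ ?_ ?_
      · intro x hx; exact (mem_Fx hM).2 (fx_add ((mem_Fx hM).1 hx) hu')
      · intro x hx; exact (mem_Fx hM).2 (fx_add ((mem_Fx hM).1 hx) hu')
      · intro x _; rw [add_assoc, CharTwo.add_self_eq_zero, add_zero]
      · intro x _; rw [add_assoc, CharTwo.add_self_eq_zero, add_zero]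
      · intro x _; rfl
    have : (U.card : ℤ) * ∑ x ∈ Fx Ω (n + n), sg (f x)
        = ∑ u ∈ U, ∑ x ∈ Fx Ω (n + n), sg (f (x + u)) := by
      rw [Finset.sum_congr rfl step1]; simp
    rw [this, Finset.sum_comm]
    refine Finset.sum_congr rfl fun x hx => ?_
    have hx' := (mem_Fx hM).1 hx
    rw [Finset.sum_congr rfl (shift x hx'), ← Finset.mul_sum,
      fib (fun y => sg (tr2 n ((1 + F x + F x ^ 2 ^ n) * y))), orth hn (cfix x hx'), cardU]
    congr 1
    split_ifs <;> simp
  -- values on the coset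
  have val : ∀ x, x ^ 2 ^ (n + n) = x → 1 + F x + F x ^ 2 ^ n = 0 → sg (f x) = 1 := by
    intro x hx h
    have hz : F x ^ 2 ^ n = F x + 1 := by
      linear_combination h - (1 + F x) * (two0 (Ω := Ω))
    have : f x = 0 := by
      rw [hfE x hx, E2_artin hne hz, mul_comm, trK _ _ (hFM x hx) ht, hz,
        show F x + (F x + 1) = 1 + F x * 2 by ring, two0, mul_zero, add_zero, one_mul, htr]
      push_cast
      exact CharTwo.add_self_eq_zero _
    rw [this]; simp [sg]
  -- the coset
  obtain ⟨S, hS1, hS2⟩ := lin_roots k e hk he β hb0 hbe 1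
  obtain ⟨v, hv⟩ : S.Nonempty := by
    rw [← Finset.card_pos, hS1]; positivity
  have hv1 : F v = 1 := (hS2 v).1 hv
  have hvK : v ^ 2 ^ n = v := h4 v (by rw [hv1, h1])
  obtain ⟨S', hS1', hS2'⟩ := lin_roots n 1 hn le_rfl (fun _ => (1 : Ω)) one_ne_zero one_ne_zero v
  obtain ⟨x0, hx0⟩ : S'.Nonempty := by
    rw [← Finset.card_pos, hS1']; positivity
  have hx1 : x0 + x0 ^ 2 ^ n = v := by
    have := (hS2' x0).1 hx0
    simpa [Lpoly_eq, Finset.sum_range_succ] using this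
  have hx0M : x0 ^ 2 ^ (n + n) = x0 := by
    have h2 := congrArg (· ^ 2 ^ n) hx1
    simp only [addpow, ← pow_mul, ← pow_add, hvK] at h2
    linear_combination h2 - hx1
  have hFx0 : F x0 + F x0 ^ 2 ^ n = 1 := by
    rw [hFfr, ← hFadd, hx1, hv1]
  have cos : ((Fx Ω (n + n)).filter (fun x => 1 + F x + F x ^ 2 ^ n = 0)).card = U.card := by
    refine Finset.card_bij' (fun x _ => x + x0) (fun x _ => x + x0) ?_ ?_ ?_ ?_
    · intro x hx
      rw [Finset.mem_filter] at hx
      rw [memU, hFadd, addpow]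
      linear_combination hx.2 + hFx0 - (F x + F x0) * (two0 (Ω := Ω))
    · intro x hx
      rw [memU] at hx
      rw [Finset.mem_filter, mem_Fx hM]
      refine ⟨fx_add (hU x hx) hx0M, ?_⟩
      rw [hFadd, addpow]
      linear_combination hx + hFx0 + (1 + F x) * (two0 (Ω := Ω))
    · intro x _; rw [add_assoc, CharTwo.add_self_eq_zero, add_zero]
    · intro x _; rw [add_assoc, CharTwo.add_self_eq_zero, add_zero]
  have main2 : ∑ x ∈ Fx Ω (n + n), sg (f x) *
        (if 1 + F x + F x ^ 2 ^ n = 0 then (U.card : ℤ) else 0) = U.card * U.card := by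
    have : ∀ x ∈ Fx Ω (n + n), sg (f x) *
        (if 1 + F x + F x ^ 2 ^ n = 0 then (U.card : ℤ) else 0)
        = if 1 + F x + F x ^ 2 ^ n = 0 then (U.card : ℤ) else 0 := by
      intro x hx
      split_ifs with h
      · rw [val x ((mem_Fx hM).1 hx) h, one_mul]
      · simp
    rw [Finset.sum_congr rfl this, ← Finset.sum_filter]
    simp [cos]
  rw [main2] at main
  have hpos : (U.card : ℤ) ≠ 0 := by rw [cardU]; positivity
  rw [← cardU]
  exact mul_left_cancel₀ hpos main

/-- the counting -/
theorem count [PerfectRing Ω 2] [IsAlgClosed Ω] {n : ℕ} (k m e : ℕ) (hk : 1 ≤ k) (hm : 1 ≤ m)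
    (hnkm : n = k * m) (β : ℕ → Ω) (hβ : ∀ i, β i ^ 2 ^ n = β i)
    {t : Ω} (ht : t ^ 2 ^ n = t) :
    ((((Fx Ω (n + n)) ×ˢ (Fx Ω (n + n))).filter
      (fun z => z.2 ^ (2 ^ k) - z.2 = z.1 * RFt k e β t z.1)).card : ℤ)
      = 2 ^ (n + n) + (2 ^ k - 1) *
        ∑ x ∈ Fx Ω (n + n), sg (tr2 (n + n) (x * RFt k e β t x)) := by
  have hn : 1 ≤ n := by rw [hnkm]; exact Nat.mul_pos hk hm
  have hM : 1 ≤ n + n := by omega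
  set R := RFt k e β t with hR
  have hβM : ∀ i, β i ^ 2 ^ (n + n) = β i := fun i => fx_dbl (hβ i)
  have htM := fx_dbl ht
  have hRM : ∀ x, x ^ 2 ^ (n + n) = x → R x ^ 2 ^ (n + n) = R x := by
    intro x hx
    rw [hR, RFt]
    refine fx_add ?_ (fx_mul ?_ hx)
    · rw [RF]
      refine fx_sum _ _ fun i _ => fx_mul ?_ (fixpow _ hx)
      rw [aRF]
      exact fx_sum _ _ fun j _ => rt_fix _ (fx_mul (hβM _) (hβM _))
    · rw [alphaF, gammaF, adj]
      refine fx_add (fx_sum _ _ fun i _ => fx_sum _ _ fun j _ =>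
        fx_mul (rt_fix _ (hβM _)) (rt_fix _ (hβM _))) (fixpow _ ?_)
      exact fx_sum _ _ fun i _ => rt_fix _ (fx_mul (hβM _) htM)
  have hRlin : ∀ h x, h ^ 2 ^ k = h → R (h * x) = h * R x := by
    intro h x hh
    have hp : ∀ i, h ^ (2 ^ k) ^ i = h := by
      intro i
      induction i with
      | zero => simp
      | succ i ih => rw [pow_succ, pow_mul, ih, hh]
    rw [hR, RFt, RFt, RF, RF, mul_add, Finset.mul_sum]
    congr 1
    · refine Finset.sum_congr rfl fun i _ => ?_
      rw [mul_pow, hp]; ring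
    · ring
  set L := Fx Ω (n + n) with hL
  set f : Ω → ℤ := fun u => ∑ x ∈ L, sg (tr2 (n + n) (u * (x * R x))) with hf
  have kfix : ∀ u : Ω, u ^ 2 ^ k = u → u ^ 2 ^ (n + n) = u := by
    intro u hu
    have : ∀ i, u ^ 2 ^ (k * i) = u := by
      intro i
      induction i with
      | zero => simp
      | succ i ih => rw [mul_add, mul_one, pow_add, pow_mul, ih, hu]
    rw [hnkm, ← mul_add]; exact this _
  -- step 1
  have st1 : (2 ^ (n + n) : ℤ) * (((L ×ˢ L).filter
      (fun z => z.2 ^ (2 ^ k) - z.2 = z.1 * R z.1)).card : ℤ)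
      = ∑ z ∈ L ×ˢ L, ∑ u ∈ L, sg (tr2 (n + n) ((z.2 ^ 2 ^ k + z.2 + z.1 * R z.1) * u)) := by
    rw [Finset.card_filter]
    push_cast
    rw [Finset.mul_sum]
    refine Finset.sum_congr rfl fun z hz => ?_
    rw [Finset.mem_product] at hz
    have hz1 := (mem_Fx hM).1 hz.1
    have hz2 := (mem_Fx hM).1 hz.2
    rw [orth hM (fx_add (fx_add (fixpow _ hz2) hz2) (fx_mul hz1 (hRM _ hz1)))]
    have : z.2 ^ (2 ^ k) - z.2 = z.1 * R z.1 ↔ z.2 ^ 2 ^ k + z.2 + z.1 * R z.1 = 0 := by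
      rw [CharTwo.sub_eq_add, CharTwo.add_eq_zero]
    simp only [this, mul_ite, mul_one, mul_zero]
  have st2 : ∑ z ∈ L ×ˢ L, ∑ u ∈ L, sg (tr2 (n + n) ((z.2 ^ 2 ^ k + z.2 + z.1 * R z.1) * u))
      = ∑ u ∈ L, f u * (if u ^ 2 ^ k + u = 0 then 2 ^ (n + n) else 0) := by
    rw [Finset.sum_comm]
    refine Finset.sum_congr rfl fun u hu => ?_
    have hu' := (mem_Fx hM).1 hu
    rw [Finset.sum_product, hf, Finset.sum_mul]
    refine Finset.sum_congr rfl fun x hx => ?_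
    have hx' := (mem_Fx hM).1 hx
    have hc : (u ^ 2 ^ k + u) ^ 2 ^ (n + n) = u ^ 2 ^ k + u := fx_add (fixpow _ hu') hu'
    have hrep : ∑ y ∈ L, sg (tr2 (n + n) ((u ^ 2 ^ k + u) * y))
        = ∑ y ∈ L, sg (tr2 (n + n) ((y ^ 2 ^ k + y) * u)) := by
      symm
      refine Finset.sum_bij (fun y _ => y ^ 2 ^ k) ?_ ?_ ?_ ?_
      · intro y hy; exact (mem_Fx hM).2 (fixpow _ ((mem_Fx hM).1 hy))
      · intro y _ y' _ h; exact powinj k h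
      · intro y hy
        refine ⟨rt Ω k y, (mem_Fx hM).2 (rt_fix _ ((mem_Fx hM).1 hy)), rt_pow k y⟩
      · intro y hy
        have hy' := (mem_Fx hM).1 hy
        congr 1
        rw [add_mul, tr2_add, add_mul, tr2_add, ← tr2_frob k (fx_mul hy' hu'), mul_pow,
          add_comm, mul_comm (y ^ 2 ^ k), mul_comm (y ^ 2 ^ k)]
    rw [← orth hM hc, hrep, Finset.mul_sum]
    refine Finset.sum_congr rfl fun y hy => ?_
    have hy' := (mem_Fx hM).1 hy
    rw [← sg_add (tr2_sq_fix (fx_mul hu' (fx_mul hx' (hRM _ hx'))))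
      (tr2_sq_fix (fx_mul (fx_add (fixpow _ hy') hy') hu')), ← tr2_add]
    congr 2; ring
  have st3 : ∑ u ∈ L, f u * (if u ^ 2 ^ k + u = 0 then 2 ^ (n + n) else 0)
      = 2 ^ (n + n) * ∑ u ∈ Fx Ω k, f u := by
    have : Fx Ω k = L.filter (fun u => u ^ 2 ^ k + u = 0) := by
      ext u
      rw [mem_Fx hk, Finset.mem_filter, CharTwo.add_eq_zero, mem_Fx hM]
      exact ⟨fun h => ⟨kfix u h, h⟩, fun h => h.2⟩
    rw [this, Finset.sum_filter, Finset.mul_sum]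
    refine Finset.sum_congr rfl fun u _ => ?_
    split_ifs <;> ring
  have st4 : ∀ u ∈ (Fx Ω k).erase 0, f u = f 1 := by
    intro u hu
    rw [Finset.mem_erase, mem_Fx hk] at hu
    obtain ⟨hu0, huk⟩ := hu
    set h := rt Ω 1 u with hh
    have hsq : h ^ 2 = u := by simpa using rt_pow 1 u
    have hhk : h ^ 2 ^ k = h := rt_fix 1 huk
    have hh0 : h ≠ 0 := by rintro h0; rw [h0] at hsq; apply hu0; rw [← hsq]; simp
    have hhM := kfix h hhk
    refine Finset.sum_bij' (fun x _ => h * x) (fun x _ => h⁻¹ * x) ?_ ?_ ?_ ?_ ?_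
    · intro x hx; exact (mem_Fx hM).2 (fx_mul hhM ((mem_Fx hM).1 hx))
    · intro x hx
      exact (mem_Fx hM).2 (fx_mul (by rw [inv_pow, hhM]) ((mem_Fx hM).1 hx))
    · intro x _; field_simp
    · intro x _; field_simp
    · intro x _
      rw [hRlin h x hhk, ← hsq]
      congr 2; ring
  have f0 : f 0 = 2 ^ (n + n) := by
    simp [hf, tr2_0, sg, hL, card_Fx hM]
  have h0mem : (0 : Ω) ∈ Fx Ω k := (mem_Fx hk).2 (by simp)
  have st5 : ∑ u ∈ Fx Ω k, f u = 2 ^ (n + n) + (2 ^ k - 1) * f 1 := by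
    rw [← Finset.add_sum_erase _ _ h0mem, Finset.sum_congr rfl st4, f0]
    rw [Finset.sum_const, Finset.card_erase_of_mem h0mem, card_Fx hk, nsmul_eq_mul,
      Nat.cast_sub Nat.one_le_two_pow]
    push_cast; rfl
  rw [st2, st3, st5] at st1
  have := mul_left_cancel₀ (by positivity) st1
  rw [this]
  simp only [hf, one_mul]

end helpers

/-- If `Tr_{q/2}(t) = n/2 + 1` then `D_{F,t}` is `𝔽_{q²}`-maximal. -/
theorem statement8 {K : Type*} [Field K] [Fintype K] [CharP K 2]
    (k m e : ℕ) (hk : 1 ≤ k) (hm : 1 ≤ m) (he : 1 ≤ e) (hmeven : Even m)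
    (hcard : Fintype.card K = 2 ^ (k * m))
    (b : ℕ → K)
    (hb1 : b 0 * b e ≠ 0)
    (hb2 : adjBar k e b 1 = 0)
    (hb3 : ∀ x : AlgebraicClosure K, adjBar k e b x = 0 →
      x ∈ Set.range (algebraMap K (AlgebraicClosure K)))
    (hb4 : ∀ x : AlgebraicClosure K, adjBar k e b (LpolyBar k e b x) = 0 →
      x ∈ Set.range (algebraMap K (AlgebraicClosure K)))
    (t : K) (ht : tr2 (k * m) t = ((k * m / 2 + 1 : ℕ) : K)) :
    (Nat.card {z : AlgebraicClosure K × AlgebraicClosure K //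
        z.1 ^ (2 ^ (k * m)) ^ 2 = z.1 ∧ z.2 ^ (2 ^ (k * m)) ^ 2 = z.2 ∧
        z.2 ^ (2 ^ k) - z.2 = z.1 * RFtBar k e b t z.1} : ℤ)
      = (2 ^ (k * m)) ^ 2 + (2 ^ k - 1) * (2 ^ k) ^ e * 2 ^ (k * m) := by
  have hn : 1 ≤ k * m := Nat.mul_pos hk hm
  set n := k * m with hnkm
  set φ := algebraMap K (AlgebraicClosure K) with hφ
  set β : ℕ → AlgebraicClosure K := fun i => φ (b i) with hβdef
  have hK : ∀ x : K, φ x ^ 2 ^ n = φ x := by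
    intro x
    rw [← map_pow, ← hcard, FiniteField.pow_card]
  have hR : ∀ x, RFtBar k e b t x = RFt k e β (φ t) x := by
    intro x
    rw [RFtBar, RFt, RF, alphaF, alphaF]
    simp only [aRF, gammaF, adj, map_add, map_sum, map_pow, map_mul, rt_map, hβdef, hφ]
  have hS := S1 hn (hmeven.mul_left k) k e hk he β (fun i => hK (b i))
    (by simpa [hβdef] using left_ne_zero_of_mul hb1)
    (by simpa [hβdef] using right_ne_zero_of_mul hb1) hb2
    (fun x hx => by
      obtain ⟨y, rfl⟩ := hb4 x hx
      exact hK y) (hK t)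
    (by
      have := congrArg φ ht
      rw [map_natCast] at this
      rw [← this]
      simp [tr2])
  have hC := count k m e hk hm hnkm β (fun i => hK (b i)) (hK t)
  rw [hS] at hC
  have hM : 1 ≤ n + n := by omega
  have hpow : (2 ^ n) ^ 2 = 2 ^ (n + n) := by rw [← pow_mul, mul_two]
  have hcardeq : Nat.card {z : AlgebraicClosure K × AlgebraicClosure K //
        z.1 ^ (2 ^ n) ^ 2 = z.1 ∧ z.2 ^ (2 ^ n) ^ 2 = z.2 ∧
        z.2 ^ (2 ^ k) - z.2 = z.1 * RFtBar k e b t z.1}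
      = (((Fx (AlgebraicClosure K) (n + n)) ×ˢ (Fx (AlgebraicClosure K) (n + n))).filter
      (fun z => z.2 ^ (2 ^ k) - z.2 = z.1 * RFt k e β (φ t) z.1)).card := by
    apply Nat.subtype_card
    intro z
    rw [Finset.mem_filter, Finset.mem_product, mem_Fx hM, mem_Fx hM, hR, hpow, and_assoc]
  rw [hcardeq, hC, ← pow_mul 2 n 2, ← mul_two, ← pow_mul 2 k e]
  ring

end
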